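/- arXiv:2310.00012 — 2 statements merged into one kernel-verified Lean document; each statement's English description precedes it below -/
import Mathlib

section
/- For every natural number n and every real x with -1 ≤ x ≤ 1, the derivative of the n-th Legendre polynomial satisfies |P_n'(x)| ≤ n(n+1)/2. -/
open Polynomial

/-- The `n`-th Legendre polynomial, defined via Rodrigues' formula
`P n = (1/(2^n n!)) * d^n/dx^n (x^2 - 1)^n`. -/
noncomputable def legendre (n : ℕ) : Polynomial ℝ :=
  C (1 / ((2 : ℝ) ^ n * n.factorial)) * derivative^[n] ((X ^ 2 - 1) ^ n)

theorem eval_iterate_derivative_X_sub_C_pow_mul {R : Type*} [CommRing R] (a : R) (n : ℕ)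
    (q : R[X]) :
    (derivative^[n] ((X - C a) ^ n * q)).eval a = n.factorial * q.eval a := by
  induction n generalizing q with
  | zero => simp
  | succ n ih =>
    have h : derivative ((X - C a) ^ (n + 1) * q) =
        (X - C a) ^ n * (((n + 1 : ℕ) : R[X]) * q + (X - C a) * derivative q) := by
      simp only [derivative_mul, derivative_X_sub_C_pow, Nat.add_sub_cancel, map_natCast]
      ring
    rw [Function.iterate_succ_apply, h, ih, Nat.factorial_succ]
    simp only [eval_add, eval_mul, eval_natCast, eval_sub, eval_X, eval_C]
    push_cast
    ring

/-- The differential equations satisfied by the iterated derivatives of `(X ^ 2 - 1) ^ n`. -/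
theorem iterate_derivative_X_sq_sub_one_pow_ode {R : Type*} [CommRing R] (n k : ℕ) :
    (X ^ 2 - 1) * derivative^[k + 2] ((X ^ 2 - 1 : R[X]) ^ n) =
      2 * ((n : R[X]) - (k : R[X]) - 1) * X * derivative^[k + 1] ((X ^ 2 - 1) ^ n) +
        ((k : R[X]) + 1) * (2 * (n : R[X]) - (k : R[X])) * derivative^[k] ((X ^ 2 - 1) ^ n) := by
  induction k with
  | zero =>
    have h : (X ^ 2 - 1) * derivative ((X ^ 2 - 1 : R[X]) ^ n) =
        2 * (n : R[X]) * X * (X ^ 2 - 1) ^ n := by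
      cases n with
      | zero => simp
      | succ n =>
        simp only [derivative_pow, derivative_sub, derivative_X, derivative_one,
          Nat.add_sub_cancel, map_natCast]
        push_cast
        ring
    have h' := congrArg derivative h
    simp only [derivative_mul, derivative_sub, derivative_X_sq, derivative_one, derivative_X,
      derivative_natCast, derivative_ofNat, C_ofNat] at h'
    simp only [Function.iterate_succ_apply', Function.iterate_zero, id_eq, Nat.cast_zero, zero_add]
    linear_combination h'
  | succ k ih =>
    have h' := congrArg derivative ih
    simp only [derivative_mul, derivative_add, derivative_sub, derivative_X_sq, derivative_one,
      derivative_X, derivative_natCast, derivative_ofNat, C_ofNat,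
      ← Function.iterate_succ_apply' derivative] at h'
    simp only [Nat.succ_eq_add_one, add_assoc, Nat.reduceAdd] at h' ⊢
    push_cast
    linear_combination h'

theorem iterate_derivative_legendre (n k : ℕ) :
    derivative^[k] (legendre n) =
      C (1 / ((2 : ℝ) ^ n * n.factorial)) * derivative^[n + k] ((X ^ 2 - 1) ^ n) := by
  rw [legendre, iterate_derivative_C_mul, ← Function.iterate_add_apply, add_comm k n]

/-- Legendre's differential equation. -/
theorem legendre_ode (n : ℕ) :
    (X ^ 2 - 1) * derivative (derivative (legendre n)) + 2 * X * derivative (legendre n) =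
      (n : ℝ[X]) * ((n : ℝ[X]) + 1) * legendre n := by
  have h := iterate_derivative_X_sq_sub_one_pow_ode (R := ℝ) n n
  have h1 := iterate_derivative_legendre n 1
  have h2 := iterate_derivative_legendre n 2
  simp only [Function.iterate_succ_apply', Function.iterate_zero, id_eq] at h1 h2
  rw [h2, h1, legendre]
  simp only [Function.iterate_succ_apply'] at h ⊢
  linear_combination C (1 / ((2 : ℝ) ^ n * n.factorial)) * h

theorem derivative_legendre_ode (n : ℕ) :
    (X ^ 2 - 1) * derivative (derivative (derivative (legendre n))) +
      4 * X * derivative (derivative (legendre n)) =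
      ((n : ℝ[X]) - 1) * ((n : ℝ[X]) + 2) * derivative (legendre n) := by
  have h := congrArg derivative (legendre_ode n)
  simp only [derivative_mul, derivative_add, derivative_sub, derivative_X_sq, derivative_one,
    derivative_X, derivative_natCast, derivative_ofNat, C_ofNat] at h
  linear_combination h

theorem legendre_eval_one (n : ℕ) : (legendre n).eval 1 = 1 := by
  have h : (X ^ 2 - 1 : ℝ[X]) ^ n = (X - C 1) ^ n * (X + 1) ^ n := by
    rw [← mul_pow, C_1]
    ring
  have hn : (n.factorial : ℝ) ≠ 0 := by positivity
  rw [legendre, h, eval_mul, eval_iterate_derivative_X_sub_C_pow_mul]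
  simp only [eval_C, eval_pow, eval_add, eval_X, eval_one, one_add_one_eq_two]
  field_simp

theorem legendre_eval_neg_one (n : ℕ) : (legendre n).eval (-1) = (-1) ^ n := by
  have h : (X ^ 2 - 1 : ℝ[X]) ^ n = (X - C (-1)) ^ n * (X - 1) ^ n := by
    rw [← mul_pow, C_neg, C_1]
    ring
  have hn : (n.factorial : ℝ) ≠ 0 := by positivity
  have h2 : (-1 - 1 : ℝ) ^ n = (-1) ^ n * 2 ^ n := by
    rw [← mul_pow]
    norm_num
  rw [legendre, h, eval_mul, eval_iterate_derivative_X_sub_C_pow_mul]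
  simp only [eval_C, eval_pow, eval_sub, eval_X, eval_one, h2]
  field_simp

theorem derivative_legendre_eval_one (n : ℕ) :
    (derivative (legendre n)).eval 1 = (n : ℝ) * (n + 1) / 2 := by
  have h := congrArg (eval 1) (legendre_ode n)
  simp only [eval_add, eval_mul, eval_sub, eval_pow, eval_X, eval_one, eval_natCast, eval_ofNat,
    legendre_eval_one] at h
  linear_combination h / 2

theorem derivative_legendre_eval_neg_one (n : ℕ) :
    (derivative (legendre n)).eval (-1) = -((-1) ^ n * ((n : ℝ) * (n + 1) / 2)) := by
  have h := congrArg (eval (-1)) (legendre_ode n)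
  simp only [eval_add, eval_mul, eval_sub, eval_pow, eval_X, eval_one, eval_natCast, eval_ofNat,
    legendre_eval_neg_one] at h
  linear_combination -h / 2

/-- The Sonin function of `P_n'`, multiplied by `(n - 1) * (n + 2)`. -/
noncomputable def legendreSonin (n : ℕ) : ℝ[X] :=
  ((n : ℝ[X]) - 1) * ((n : ℝ[X]) + 2) * derivative (legendre n) ^ 2 +
    (1 - X ^ 2) * derivative (derivative (legendre n)) ^ 2

theorem derivative_legendreSonin (n : ℕ) :
    derivative (legendreSonin n) = 6 * X * derivative (derivative (legendre n)) ^ 2 := by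
  have h := derivative_legendre_ode n
  simp only [legendreSonin, derivative_mul, derivative_add, derivative_sub, derivative_X,
    derivative_one, derivative_natCast, derivative_ofNat, derivative_sq, C_ofNat]
  linear_combination -2 * derivative (derivative (legendre n)) * h

theorem legendreSonin_eval_le (n : ℕ) (x : ℝ) (hx₁ : -1 ≤ x) (hx₂ : x ≤ 1) :
    (legendreSonin n).eval x ≤ ((n : ℝ) - 1) * (n + 2) * ((n : ℝ) * (n + 1) / 2) ^ 2 := by
  have hd (y : ℝ) : deriv (fun z ↦ (legendreSonin n).eval z) y =
      y * (6 * (derivative (derivative (legendre n))).eval y ^ 2) := by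
    rw [Polynomial.deriv, derivative_legendreSonin]
    simp only [eval_mul, eval_pow, eval_X, eval_ofNat]
    ring
  rcases le_total 0 x with hx | hx
  · have hmono : MonotoneOn (fun z ↦ (legendreSonin n).eval z) (Set.Icc 0 1) := by
      refine monotoneOn_of_deriv_nonneg (convex_Icc 0 1) (legendreSonin n).continuousOn
        (legendreSonin n).differentiable.differentiableOn fun y hy ↦ ?_
      rw [interior_Icc] at hy
      rw [hd]
      exact mul_nonneg hy.1.le (by positivity)
    refine (hmono ⟨hx, hx₂⟩ ⟨zero_le_one, le_rfl⟩ hx₂).trans_eq ?_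
    simp [legendreSonin, derivative_legendre_eval_one]
  · have hanti : AntitoneOn (fun z ↦ (legendreSonin n).eval z) (Set.Icc (-1) 0) := by
      refine antitoneOn_of_deriv_nonpos (convex_Icc (-1) 0) (legendreSonin n).continuousOn
        (legendreSonin n).differentiable.differentiableOn fun y hy ↦ ?_
      rw [interior_Icc] at hy
      rw [hd]
      exact mul_nonpos_of_nonpos_of_nonneg hy.2.le (by positivity)
    refine (hanti ⟨le_rfl, by norm_num⟩ ⟨hx₁, hx⟩ hx₁).trans_eq ?_
    simp [legendreSonin, derivative_legendre_eval_neg_one, mul_pow, ← pow_mul, mul_comm n 2]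

/-- For `-1 ≤ x ≤ 1`, `|P_n'(x)| ≤ n(n+1)/2`. -/
theorem abs_legendre_deriv_le (n : ℕ) (x : ℝ) (hx₁ : -1 ≤ x) (hx₂ : x ≤ 1) :
    |(derivative (legendre n)).eval x| ≤ (n : ℝ) * (n + 1) / 2 := by
  match n with
  | 0 => simp [legendre]
  | 1 => norm_num [legendre]
  | n + 2 =>
    refine abs_le_of_sq_le_sq ?_ (by positivity)
    have h := legendreSonin_eval_le (n + 2) x hx₁ hx₂
    simp only [legendreSonin, eval_add, eval_mul, eval_sub, eval_pow, eval_X, eval_one,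
      eval_natCast, eval_ofNat] at h
    have hx : 0 ≤ (1 - x ^ 2) * (derivative (derivative (legendre (n + 2)))).eval x ^ 2 :=
      mul_nonneg (by nlinarith) (sq_nonneg _)
    have hn : 0 < (((n + 2 : ℕ) : ℝ) - 1) * (((n + 2 : ℕ) : ℝ) + 2) := by
      push_cast
      exact mul_pos (by linarith [n.cast_nonneg (α := ℝ)]) (by positivity)
    exact le_of_mul_le_mul_left (by linarith) hn
end

section
/- For every natural number n ≥ 1, the Legendre polynomials satisfy the derivative recurrence P_{n+1}'(x) + P_{n-1}'(x) = 2x·P_n'(x) + P_n(x), as an identity of polynomials. -/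
open Polynomial

/-- Passing from `n` to `n + 1`, the Rodrigues coefficient is divided by `2 (n + 1)`. -/
theorem legendre_coeff_succ (n : ℕ) :
    1 / ((2 : ℝ) ^ (n + 1) * (n + 1).factorial) * (2 * (n + 1)) =
      1 / ((2 : ℝ) ^ n * n.factorial) := by
  rw [Nat.factorial_succ]
  push_cast
  field_simp
  ring

theorem derivative_legendre (n : ℕ) :
    derivative (legendre n) =
      C (1 / ((2 : ℝ) ^ n * n.factorial)) * derivative^[n + 1] ((X ^ 2 - 1) ^ n) := by
  rw [legendre, derivative_C_mul, Function.iterate_succ_apply']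

theorem derivative_X_sq_sub_one_pow_succ (n : ℕ) :
    derivative ((X ^ 2 - 1 : ℝ[X]) ^ (n + 1)) =
      C (2 * (n + 1) : ℝ) * ((X ^ 2 - 1) ^ n * X) := by
  rw [derivative_pow_succ]
  simp [map_ofNat]
  ring

theorem derivative_legendre_succ (n : ℕ) :
    derivative (legendre (n + 1)) =
      C (1 / ((2 : ℝ) ^ n * n.factorial)) * derivative^[n + 1] ((X ^ 2 - 1) ^ n * X) := by
  rw [derivative_legendre, Function.iterate_succ_apply, derivative_X_sq_sub_one_pow_succ,
    iterate_derivative_C_mul, ← mul_assoc, ← C_mul, legendre_coeff_succ]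

/-- `P_{n+1}' = x P_n' + (n + 1) P_n`. -/
theorem derivative_legendre_succ_eq_X_mul (n : ℕ) :
    derivative (legendre (n + 1)) =
      X * derivative (legendre n) + C (n + 1 : ℝ) * legendre n := by
  rw [derivative_legendre_succ, iterate_derivative_mul_X, derivative_legendre, legendre]
  simp only [nsmul_eq_mul, Nat.add_sub_cancel, map_add, map_natCast, map_one, Nat.cast_add,
    Nat.cast_one]
  ring

/-- `P_{n+2}' = P_n' + (2 n + 3) P_{n+1}`. -/
theorem derivative_legendre_add_two (n : ℕ) :
    derivative (legendre (n + 2)) =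
      derivative (legendre n) + C (2 * n + 3 : ℝ) * legendre (n + 1) := by
  have h : derivative ((X ^ 2 - 1 : ℝ[X]) ^ (n + 1) * X) =
      C (2 * n + 3 : ℝ) * (X ^ 2 - 1) ^ (n + 1) + C (2 * (n + 1) : ℝ) * (X ^ 2 - 1) ^ n := by
    rw [derivative_mul, derivative_X_sq_sub_one_pow_succ]
    simp [map_ofNat]
    ring
  rw [derivative_legendre_succ, Function.iterate_succ_apply, h, iterate_map_add,
    iterate_derivative_C_mul, iterate_derivative_C_mul, derivative_legendre n, legendre,
    ← legendre_coeff_succ n, C_mul (a := 1 / _)]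
  ring

/-- Derivative recurrence: `P_{n+1}'(x) + P_{n-1}'(x) = 2x P_n'(x) + P_n(x)`. -/
theorem legendre_deriv_recurrence (n : ℕ) (hn : 1 ≤ n) :
    derivative (legendre (n + 1)) + derivative (legendre (n - 1)) =
      C 2 * X * derivative (legendre n) + legendre n := by
  obtain ⟨m, rfl⟩ := Nat.exists_eq_add_of_le' hn
  have h₁ := derivative_legendre_succ_eq_X_mul (m + 1)
  have h₂ := derivative_legendre_add_two m
  simp only [Nat.add_sub_cancel, map_add, map_mul, map_natCast, map_one, map_ofNat,
    Nat.cast_add, Nat.cast_one] at h₁ h₂ ⊢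
  linear_combination 2 * h₁ - h₂
end
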